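/- Let γ ∈ (−3,−2), let k > (γ+3)/2 and set m(v) = ⟨v⟩^k. Then limsup_{|v|→∞} ζ_m(v) ⟨v⟩^{−γ} ≤ 2((γ+3)/2 − k) and limsup_{|v|→∞} ζ̃_m(v) ⟨v⟩^{−γ} ≤ 2((γ+3)/2 − k). -/

import Mathlib

noncomputable section

open MeasureTheory Real Filter

abbrev V3 := EuclideanSpace ℝ (Fin 3)

/-- Japanese bracket ⟨v⟩ = (1+|v|²)^{1/2}. -/
def jap (v : V3) : ℝ := Real.sqrt (1 + ‖v‖ ^ 2)

/-- Standard Gaussian μ on ℝ³. -/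
def gaussM (v : V3) : ℝ := (2 * Real.pi) ^ (-(3 : ℝ) / 2) * Real.exp (-‖v‖ ^ 2 / 2)

/-- Landau kernel matrix a_{ij}(z). -/
def aker (γ : ℝ) (z : V3) (i j : Fin 3) : ℝ :=
  ‖z‖ ^ (γ + 2) * ((if i = j then (1 : ℝ) else 0) - z i * z j / ‖z‖ ^ 2)

/-- ā_{ij} = a_{ij} * μ. -/
def abar (γ : ℝ) (v : V3) (i j : Fin 3) : ℝ := ∫ w : V3, aker γ (v - w) i j * gaussM w

def bker (γ : ℝ) (z : V3) (i : Fin 3) : ℝ := -2 * ‖z‖ ^ γ * z i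

/-- b̄_i = b_i * μ. -/
def bbar (γ : ℝ) (v : V3) (i : Fin 3) : ℝ := ∫ w : V3, bker γ (v - w) i * gaussM w

/-- J_β(v) = ∫ |v−w|^β μ(w) dw. -/
def Jfun (β : ℝ) (v : V3) : ℝ := ∫ w : V3, ‖v - w‖ ^ β * gaussM w

/-- c̄(v) = −2(γ+3) J_γ(v). -/
def cbar (γ : ℝ) (v : V3) : ℝ := -2 * (γ + 3) * Jfun γ v

/-- ℓ₁(v). -/
def ell1 (γ : ℝ) (v : V3) : ℝ :=
  ∫ w : V3, (1 - ((∑ i, v i * w i) / (‖v‖ * ‖w‖)) ^ 2) * ‖w‖ ^ (γ + 2) * gaussM (v - w)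

/-- Squared Euclidean norm of the cross product of two vectors in ℝ³. -/
def crossSq (a b : V3) : ℝ :=
  ∑ i, (crossProduct (R := ℝ) (fun k => a k) (fun k => b k) i) ^ 2

/-- ℓ₂(v). -/
def ell2 (γ : ℝ) (v : V3) : ℝ :=
  ∫ w : V3,
    (1 - (1 / 2) * crossSq (‖v‖⁻¹ • v) (‖w‖⁻¹ • w)) * ‖w‖ ^ (γ + 2) * gaussM (v - w)

/-- Projection P_v ξ on the direction v. -/
def Pv (v ξ : V3) : V3 := ((∑ i, ξ i * v i) / ‖v‖ ^ 2) • v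

/-- Partial derivative in the i-th coordinate direction. -/
def pd (i : Fin 3) (f : V3 → ℝ) : V3 → ℝ := fun v => fderiv ℝ f v (EuclideanSpace.single i 1)

/-- Anisotropic gradient ∇̃f = P_v ∇f + ⟨v⟩ (I − P_v) ∇f. -/
def anisoGrad (f : V3 → ℝ) (v : V3) : V3 :=
  Pv v (gradient f v) + jap v • (gradient f v - Pv v (gradient f v))

/-- The filter |v| → ∞ on ℝ³. -/
def normAtTop : Filter V3 := Filter.comap (fun v : V3 => ‖v‖) Filter.atTop

/-- ζ_m(v) = Σ ā_{ij} ∂_{ij}m/m + Σ ā_{ij} (∂_i m/m)(∂_j m/m) + 2 Σ b̄_i ∂_i m/m − c̄/2. -/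
def zeta (γ : ℝ) (m : V3 → ℝ) (v : V3) : ℝ :=
  (∑ i, ∑ j, abar γ v i j * pd i (pd j m) v / m v)
  + (∑ i, ∑ j, abar γ v i j * (pd i m v / m v) * (pd j m v / m v))
  + 2 * (∑ i, bbar γ v i * pd i m v / m v)
  - cbar γ v / 2

/-- ζ̃_m(v) = Σ ā_{ij} (∂_i m/m)(∂_j m/m) + Σ b̄_i ∂_i m/m − c̄/2. -/
def zetaT (γ : ℝ) (m : V3 → ℝ) (v : V3) : ℝ :=
  (∑ i, ∑ j, abar γ v i j * (pd i m v / m v) * (pd j m v / m v))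
  + (∑ i, bbar γ v i * pd i m v / m v)
  - cbar γ v / 2

/-- ζ_{m,ω}(v). -/
def zetaMW (γ : ℝ) (m ω : V3 → ℝ) (v : V3) : ℝ :=
  (∑ i, ∑ j, abar γ v i j * pd i (pd j ω) v / ω v)
  + (∑ i, ∑ j, abar γ v i j * (pd i ω v / ω v) * (pd j ω v / ω v))
  - 2 * (∑ i, ∑ j, abar γ v i j * (pd i ω v / ω v) * (pd j m v / m v))

instance normAtTop_neBot : normAtTop.NeBot := by
  refine Filter.comap_neBot fun t ht => ?_
  obtain ⟨a, ha⟩ := Filter.mem_atTop_sets.1 ht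
  obtain ⟨x, hx⟩ := NormedSpace.exists_lt_norm ℝ V3 a
  exact ⟨x, ha _ hx.le⟩

instance normAtTop_isCountablyGenerated : normAtTop.IsCountablyGenerated := by
  unfold normAtTop; infer_instance

lemma tendsto_norm_normAtTop : Tendsto (fun v : V3 => ‖v‖) normAtTop atTop := tendsto_comap

lemma jap_sq (v : V3) : jap v ^ 2 = 1 + ‖v‖ ^ 2 := Real.sq_sqrt (by positivity)

lemma jap_pos (v : V3) : 0 < jap v := Real.sqrt_pos.2 (by positivity)

lemma norm_le_jap (v : V3) : ‖v‖ ≤ jap v := Real.le_sqrt_of_sq_le (by linarith)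

lemma jap_le_one_add_norm (v : V3) : jap v ≤ 1 + ‖v‖ :=
  Real.sqrt_le_iff.2 ⟨by positivity, by nlinarith [norm_nonneg v]⟩

lemma tendsto_norm_sub_div_jap (w : V3) :
    Tendsto (fun v => ‖v - w‖ / jap v) normAtTop (nhds 1) := by
  have hn := tendsto_norm_normAtTop
  have h0 : Tendsto (fun v : V3 => (1 + ‖w‖) / ‖v‖) normAtTop (nhds 0) :=
    tendsto_const_nhds.div_atTop hn
  rw [tendsto_iff_norm_sub_tendsto_zero]
  refine squeeze_zero' (Eventually.of_forall fun _ => norm_nonneg _) ?_ h0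
  filter_upwards [hn.eventually_ge_atTop 1] with v hv
  have hj := jap_pos v
  have h1 := norm_le_jap v
  have h2 := jap_le_one_add_norm v
  have h3 := norm_sub_le v w
  have h4 := norm_sub_norm_le v w
  rw [div_sub_one hj.ne', norm_div, Real.norm_of_nonneg hj.le]
  refine div_le_div₀ (by positivity) ?_ (by linarith) h1
  rw [Real.norm_eq_abs, abs_le]
  constructor <;> linarith

lemma tendsto_jap_rpow_mul (β : ℝ) (w : V3) :
    Tendsto (fun v => jap v ^ (-β) * ‖v - w‖ ^ β) normAtTop (nhds 1) := by
  have h := (tendsto_norm_sub_div_jap w).rpow_const (p := β) (Or.inl one_ne_zero)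
  rw [Real.one_rpow] at h
  refine h.congr fun v => ?_
  rw [Real.div_rpow (norm_nonneg _) (jap_pos v).le, Real.rpow_neg (jap_pos v).le]
  ring

lemma gaussM_nonneg (v : V3) : 0 ≤ gaussM v := by unfold gaussM; positivity

lemma continuous_gaussM : Continuous gaussM := by unfold gaussM; fun_prop

lemma integral_gaussM : ∫ v, gaussM v = 1 := by
  have h := GaussianFourier.integral_rexp_neg_mul_sq_norm (V := V3) (b := 1 / 2) (by norm_num)
  have h2 : ∀ v : V3, gaussM v =
      (2 * Real.pi) ^ (-(3 : ℝ) / 2) * Real.exp (-(1 / 2) * ‖v‖ ^ 2) := fun v => by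
    rw [gaussM]; ring_nf
  simp_rw [h2]
  rw [integral_const_mul, h, finrank_euclideanSpace_fin, div_div_eq_mul_div, div_one,
    mul_comm Real.pi 2, ← Real.rpow_add (by positivity)]
  norm_num

lemma integrable_gaussM : Integrable gaussM :=
  Integrable.of_integral_ne_zero (by rw [integral_gaussM]; exact one_ne_zero)

lemma integrable_exp_neg_norm_sq_div_four :
    Integrable fun w : V3 => Real.exp (-‖w‖ ^ 2 / 4) := by
  have h := GaussianFourier.integral_rexp_neg_mul_sq_norm (V := V3) (b := 1 / 4) (by norm_num)
  have : Integrable fun w : V3 => Real.exp (-(1 / 4) * ‖w‖ ^ 2) :=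
    Integrable.of_integral_ne_zero (by rw [h]; positivity)
  convert this using 3
  ring

/-- A constant dominating polynomial factors times the Gaussian. -/
def gaussBd : ℝ := 48 * Real.exp 2 * (2 * Real.pi) ^ (-(3 : ℝ) / 2)

lemma gaussBd_nonneg : 0 ≤ gaussBd := by unfold gaussBd; positivity

lemma rpow_mul_gaussM_le {β : ℝ} (hβ : -3 < β) (w : V3) :
    (2 * (1 + ‖w‖)) ^ (-β) * gaussM w ≤ gaussBd * Real.exp (-‖w‖ ^ 2 / 4) := by
  have hw := norm_nonneg w
  have h1 : (2 * (1 + ‖w‖)) ^ (-β) ≤ 8 * (1 + ‖w‖) ^ 3 := by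
    refine (Real.rpow_le_rpow_of_exponent_le (by linarith)
      (show -β ≤ ((3 : ℕ) : ℝ) by push_cast; linarith)).trans_eq ?_
    rw [Real.rpow_natCast]; ring
  have h2 : (1 + ‖w‖) ^ 3 ≤ 6 * Real.exp (1 + ‖w‖) := by
    have := Real.pow_div_factorial_le_exp (1 + ‖w‖) (by positivity) 3
    norm_num [Nat.factorial] at this
    linarith
  have h3 : Real.exp (1 + ‖w‖) * Real.exp (-‖w‖ ^ 2 / 2) ≤
      Real.exp 2 * Real.exp (-‖w‖ ^ 2 / 4) := by
    rw [← Real.exp_add, ← Real.exp_add, Real.exp_le_exp]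
    nlinarith [sq_nonneg (‖w‖ / 2 - 1)]
  have h4 : (2 * (1 + ‖w‖)) ^ (-β) ≤ 48 * Real.exp (1 + ‖w‖) := by linarith
  calc (2 * (1 + ‖w‖)) ^ (-β) * gaussM w
      ≤ 48 * Real.exp (1 + ‖w‖) * gaussM w :=
        mul_le_mul_of_nonneg_right h4 (gaussM_nonneg w)
    _ = 48 * (2 * Real.pi) ^ (-(3 : ℝ) / 2) *
        (Real.exp (1 + ‖w‖) * Real.exp (-‖w‖ ^ 2 / 2)) := by rw [gaussM]; ring
    _ ≤ 48 * (2 * Real.pi) ^ (-(3 : ℝ) / 2) * (Real.exp 2 * Real.exp (-‖w‖ ^ 2 / 4)) :=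
        mul_le_mul_of_nonneg_left h3 (by positivity)
    _ = gaussBd * Real.exp (-‖w‖ ^ 2 / 4) := by rw [gaussBd]; ring

lemma integrable_indicator_norm_rpow {β : ℝ} (hβ : -3 < β) :
    Integrable ((Metric.ball (0 : V3) 1).indicator fun z => ‖z‖ ^ β) := by
  rw [integrable_indicator_iff Metric.isOpen_ball.measurableSet,
    integrableOn_fun_norm_addHaar volume (f := fun x : ℝ => x ^ β)]
  have h : IntegrableOn (fun x : ℝ => x ^ (β + 2)) (Set.Ioo 0 1) :=
    (intervalIntegral.integrableOn_Ioo_rpow_iff one_pos).2 (by linarith)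
  refine h.congr_fun (fun x hx => ?_) measurableSet_Ioo
  simp only [finrank_euclideanSpace_fin, smul_eq_mul]
  rw [Real.rpow_add hx.1, mul_comm]
  norm_num

lemma measurable_norm_rpow (β : ℝ) : Measurable fun z : V3 => ‖z‖ ^ β :=
  measurable_norm.pow_const β

/-- The singular part of the kernel `|z|^β`. -/
def nearKer (β : ℝ) : V3 → ℝ := (Metric.ball (0 : V3) 1).indicator fun z => ‖z‖ ^ β

/-- The bounded part of the kernel `|z|^β`. -/
def farKer (β : ℝ) : V3 → ℝ := (Metric.ball (0 : V3) 1)ᶜ.indicator fun z => ‖z‖ ^ β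

lemma nearKer_add_farKer (β : ℝ) (z : V3) : nearKer β z + farKer β z = ‖z‖ ^ β :=
  Set.indicator_self_add_compl_apply _ _ z

lemma nearKer_nonneg (β : ℝ) (z : V3) : 0 ≤ nearKer β z :=
  Set.indicator_nonneg (fun _ _ => by positivity) z

lemma farKer_nonneg (β : ℝ) (z : V3) : 0 ≤ farKer β z :=
  Set.indicator_nonneg (fun _ _ => by positivity) z

lemma farKer_le_one {β : ℝ} (hβ0 : β ≤ 0) (z : V3) : farKer β z ≤ 1 := by
  refine Set.indicator_le' (g := fun _ => (1 : ℝ)) (fun z hz => ?_) (fun _ _ => zero_le_one) z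
  exact Real.rpow_le_one_of_one_le_of_nonpos (by simpa using hz) hβ0

lemma measurable_nearKer (β : ℝ) : Measurable (nearKer β) :=
  (measurable_norm_rpow β).indicator Metric.isOpen_ball.measurableSet

lemma measurable_farKer (β : ℝ) : Measurable (farKer β) :=
  (measurable_norm_rpow β).indicator Metric.isOpen_ball.measurableSet.compl

lemma measurable_comp_const_sub {f : V3 → ℝ} (hf : Measurable f) (v : V3) :
    Measurable fun w => f (v - w) := hf.comp (measurable_const.sub measurable_id)

lemma gaussM_le (w : V3) : gaussM w ≤ (2 * Real.pi) ^ (-(3 : ℝ) / 2) := by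
  refine mul_le_of_le_one_right (by positivity) (Real.exp_le_one_iff.2 ?_)
  have := sq_nonneg ‖w‖
  linarith

lemma jap_rpow_mul_gaussM_le_of_mem_ball {β : ℝ} (hβ : -3 < β) (hβ0 : β ≤ 0) {v w : V3}
    (h : ‖v - w‖ ≤ 1) : jap v ^ (-β) * gaussM w ≤ gaussBd * Real.exp (2 - ‖v‖) := by
  have h1 := jap_le_one_add_norm v
  have h2 := norm_sub_norm_le v w
  have hw := norm_nonneg w
  calc jap v ^ (-β) * gaussM w ≤ (2 * (1 + ‖w‖)) ^ (-β) * gaussM w := by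
        refine mul_le_mul_of_nonneg_right ?_ (gaussM_nonneg w)
        exact Real.rpow_le_rpow (jap_pos v).le (by linarith) (by linarith)
    _ ≤ gaussBd * Real.exp (-‖w‖ ^ 2 / 4) := rpow_mul_gaussM_le hβ w
    _ ≤ gaussBd * Real.exp (2 - ‖v‖) := by
        refine mul_le_mul_of_nonneg_left (Real.exp_le_exp.2 ?_) gaussBd_nonneg
        nlinarith [sq_nonneg (‖w‖ / 2 - 1)]

lemma jap_rpow_mul_farKer_le {β : ℝ} (hβ0 : β ≤ 0) (v w : V3) :
    jap v ^ (-β) * farKer β (v - w) ≤ (2 * (1 + ‖w‖)) ^ (-β) := by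
  by_cases h : v - w ∈ Metric.ball (0 : V3) 1
  · rw [farKer, Set.indicator_of_notMem (by simpa using h), mul_zero]
    positivity
  · rw [farKer, Set.indicator_of_mem h]
    have hz : 1 ≤ ‖v - w‖ := by simpa using h
    have hz0 : 0 < ‖v - w‖ := by linarith
    have h1 := jap_le_one_add_norm v
    have h2 := norm_sub_norm_le v w
    have hw := norm_nonneg w
    have h3 : jap v ≤ 2 * (1 + ‖w‖) * ‖v - w‖ := by nlinarith
    calc jap v ^ (-β) * ‖v - w‖ ^ β
        ≤ (2 * (1 + ‖w‖) * ‖v - w‖) ^ (-β) * ‖v - w‖ ^ β := by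
          refine mul_le_mul_of_nonneg_right ?_ (by positivity)
          exact Real.rpow_le_rpow (jap_pos v).le h3 (by linarith)
      _ = (2 * (1 + ‖w‖)) ^ (-β) := by
          rw [Real.mul_rpow (by positivity) hz0.le, mul_assoc, ← Real.rpow_add hz0]
          simp

lemma abs_mul_mul_gaussM_le {a b : ℝ} (ha : 0 ≤ a) (hb : |b| ≤ 1) (w : V3) :
    ‖a * b * gaussM w‖ ≤ a * gaussM w := by
  rw [norm_mul, norm_mul, Real.norm_of_nonneg ha, Real.norm_of_nonneg (gaussM_nonneg w)]
  exact mul_le_mul_of_nonneg_right (mul_le_of_le_one_right ha hb) (gaussM_nonneg w)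

lemma integrable_nearKer_comp_sub {β : ℝ} (hβ : -3 < β) (v : V3) :
    Integrable fun w => nearKer β (v - w) :=
  (integrable_indicator_norm_rpow hβ).comp_sub_left v

lemma integrable_nearKer_mul {β : ℝ} (hβ : -3 < β) (v : V3) {g : V3 → ℝ} (hg : Measurable g)
    (hb : ∀ w, |g w| ≤ 1) : Integrable fun w => nearKer β (v - w) * g w * gaussM w := by
  refine Integrable.mono' ((integrable_nearKer_comp_sub hβ v).mul_const
    ((2 * Real.pi) ^ (-(3 : ℝ) / 2))) ?_ (Eventually.of_forall fun w => ?_)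
  · exact (((measurable_comp_const_sub (measurable_nearKer β) v).mul hg).mul
      continuous_gaussM.measurable).aestronglyMeasurable
  · exact (abs_mul_mul_gaussM_le (nearKer_nonneg _ _) (hb w) w).trans
      (mul_le_mul_of_nonneg_left (gaussM_le w) (nearKer_nonneg _ _))

lemma integrable_farKer_mul {β : ℝ} (hβ0 : β ≤ 0) (v : V3) {g : V3 → ℝ} (hg : Measurable g)
    (hb : ∀ w, |g w| ≤ 1) : Integrable fun w => farKer β (v - w) * g w * gaussM w := by
  refine Integrable.mono' integrable_gaussM ?_ (Eventually.of_forall fun w => ?_)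
  · exact (((measurable_comp_const_sub (measurable_farKer β) v).mul hg).mul
      continuous_gaussM.measurable).aestronglyMeasurable
  · exact (abs_mul_mul_gaussM_le (farKer_nonneg _ _) (hb w) w).trans
      (mul_le_of_le_one_left (gaussM_nonneg w) (farKer_le_one hβ0 _))

lemma integrable_norm_rpow_mul {β : ℝ} (hβ : -3 < β) (hβ0 : β ≤ 0) (v : V3) {g : V3 → ℝ}
    (hg : Measurable g) (hb : ∀ w, |g w| ≤ 1) :
    Integrable fun w => ‖v - w‖ ^ β * g w * gaussM w := by
  refine ((integrable_nearKer_mul hβ v hg hb).add (integrable_farKer_mul hβ0 v hg hb)).congr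
    (Eventually.of_forall fun w => ?_)
  simp only [Pi.add_apply, ← nearKer_add_farKer β (v - w)]
  ring

lemma tendsto_integral_nearKer {β : ℝ} (hβ : -3 < β) (hβ0 : β ≤ 0) {g : V3 → V3 → ℝ}
    (hb : ∀ v w, |g v w| ≤ 1) :
    Tendsto (fun v => ∫ w, jap v ^ (-β) * (nearKer β (v - w) * g v w * gaussM w))
      normAtTop (nhds 0) := by
  have h0 : Tendsto (fun v : V3 => (∫ z, nearKer β z) * (gaussBd * Real.exp (2 - ‖v‖)))
      normAtTop (nhds 0) := by
    have h := Real.tendsto_exp_atBot.comp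
      (tendsto_atBot_add_const_left _ 2 (tendsto_neg_atTop_atBot.comp tendsto_norm_normAtTop))
    simpa [Function.comp_def, sub_eq_add_neg] using
      (h.const_mul gaussBd).const_mul (∫ z, nearKer β z)
  refine squeeze_zero_norm (fun v => ?_) h0
  have hbd : ∀ w, ‖jap v ^ (-β) * (nearKer β (v - w) * g v w * gaussM w)‖ ≤
      nearKer β (v - w) * (gaussBd * Real.exp (2 - ‖v‖)) := fun w => by
    have hj : 0 ≤ jap v ^ (-β) := Real.rpow_nonneg (jap_pos v).le _
    rw [norm_mul, Real.norm_of_nonneg hj]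
    refine (mul_le_mul_of_nonneg_left
      (abs_mul_mul_gaussM_le (nearKer_nonneg _ _) (hb v w) w) hj).trans ?_
    by_cases h : v - w ∈ Metric.ball (0 : V3) 1
    · rw [mul_left_comm]
      exact mul_le_mul_of_nonneg_left
        (jap_rpow_mul_gaussM_le_of_mem_ball hβ hβ0 (by simpa using (mem_ball_zero_iff.1 h).le))
        (nearKer_nonneg _ _)
    · simp [nearKer, Set.indicator_of_notMem h]
  refine (norm_integral_le_of_norm_le ((integrable_nearKer_comp_sub hβ v).mul_const _)
    (Eventually.of_forall hbd)).trans_eq ?_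
  rw [integral_mul_const, integral_sub_left_eq_self (nearKer β) volume v]

lemma tendsto_integral_farKer {β : ℝ} (hβ : -3 < β) (hβ0 : β ≤ 0) {g : V3 → V3 → ℝ}
    (hg : ∀ v, Measurable (g v)) (hb : ∀ v w, |g v w| ≤ 1) {L : ℝ}
    (hL : ∀ w, Tendsto (fun v => g v w) normAtTop (nhds L)) :
    Tendsto (fun v => ∫ w, jap v ^ (-β) * (farKer β (v - w) * g v w * gaussM w))
      normAtTop (nhds L) := by
  have hlim : ∫ w, L * gaussM w = L := by rw [integral_const_mul, integral_gaussM, mul_one]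
  rw [← hlim]
  refine tendsto_integral_filter_of_dominated_convergence
    (fun w => gaussBd * Real.exp (-‖w‖ ^ 2 / 4)) (Eventually.of_forall fun v => ?_)
    (Eventually.of_forall fun v => Eventually.of_forall fun w => ?_)
    (integrable_exp_neg_norm_sq_div_four.const_mul _) (Eventually.of_forall fun w => ?_)
  · exact ((integrable_farKer_mul hβ0 v (hg v) (hb v)).const_mul _).aestronglyMeasurable
  · have hj : 0 ≤ jap v ^ (-β) := Real.rpow_nonneg (jap_pos v).le _
    rw [norm_mul, Real.norm_of_nonneg hj]
    refine (mul_le_mul_of_nonneg_left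
      (abs_mul_mul_gaussM_le (farKer_nonneg _ _) (hb v w) w) hj).trans ?_
    rw [← mul_assoc]
    exact (mul_le_mul_of_nonneg_right (jap_rpow_mul_farKer_le hβ0 v w)
      (gaussM_nonneg w)).trans (rpow_mul_gaussM_le hβ w)
  · have h := ((tendsto_jap_rpow_mul β w).mul (hL w)).mul_const (gaussM w)
    rw [one_mul] at h
    refine h.congr' ?_
    filter_upwards [tendsto_norm_normAtTop.eventually_ge_atTop (1 + ‖w‖)] with v hv
    have hmem : v - w ∈ (Metric.ball (0 : V3) 1)ᶜ := by
      have := norm_sub_norm_le v w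
      simp only [Set.mem_compl_iff, mem_ball_zero_iff, not_lt]
      linarith
    rw [farKer, Set.indicator_of_mem hmem]
    ring

/-- Convolutions of `|z|^β` with the Gaussian, modulated by a bounded factor converging to `L`,
behave like `L ⟨v⟩^β` at infinity. -/
lemma tendsto_jap_rpow_mul_integral {β : ℝ} (hβ : -3 < β) (hβ0 : β ≤ 0) {g : V3 → V3 → ℝ}
    (hg : ∀ v, Measurable (g v)) (hb : ∀ v w, |g v w| ≤ 1) {L : ℝ}
    (hL : ∀ w, Tendsto (fun v => g v w) normAtTop (nhds L)) :
    Tendsto (fun v => jap v ^ (-β) * ∫ w, ‖v - w‖ ^ β * g v w * gaussM w)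
      normAtTop (nhds L) := by
  have h := (tendsto_integral_nearKer hβ hβ0 hb).add (tendsto_integral_farKer hβ hβ0 hg hb hL)
  rw [zero_add] at h
  refine h.congr fun v => ?_
  rw [integral_const_mul, integral_const_mul, ← mul_add,
    ← integral_add (integrable_nearKer_mul hβ v (hg v) (hb v))
      (integrable_farKer_mul hβ0 v (hg v) (hb v))]
  congr 2 with w
  rw [← nearKer_add_farKer β (v - w)]
  ring

lemma tendsto_jap : Tendsto jap normAtTop atTop :=
  tendsto_atTop_mono norm_le_jap tendsto_norm_normAtTop

lemma inner_eq_sum (x y : V3) : inner ℝ x y = ∑ i, x i * y i := by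
  simp [PiLp.inner_apply, mul_comm]

lemma abs_apply_le_norm (z : V3) (i : Fin 3) : |z i| ≤ ‖z‖ := PiLp.norm_apply_le z i

lemma abs_aker_entry_le (z : V3) (i j : Fin 3) :
    |(if i = j then (1 : ℝ) else 0) - z i * z j / ‖z‖ ^ 2| ≤ 1 := by
  have h : |z i * z j / ‖z‖ ^ 2| ≤ 1 := by
    rw [abs_div, abs_mul, abs_of_nonneg (sq_nonneg ‖z‖)]
    refine div_le_one_of_le₀ ?_ (sq_nonneg _)
    rw [sq]
    exact mul_le_mul (abs_apply_le_norm z i) (abs_apply_le_norm z j) (abs_nonneg _)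
      (norm_nonneg _)
  split_ifs with hij
  · subst hij
    have h0 : 0 ≤ z i * z i / ‖z‖ ^ 2 := div_nonneg (mul_self_nonneg _) (sq_nonneg _)
    rw [abs_le] at h ⊢
    constructor <;> linarith
  · simpa using h

lemma integrable_aker_mul {γ : ℝ} (hγ : γ ∈ Set.Ioo (-3 : ℝ) (-2)) (v : V3) (i j : Fin 3) :
    Integrable fun w => aker γ (v - w) i j * gaussM w := by
  refine integrable_norm_rpow_mul (β := γ + 2) (by linarith [hγ.1]) (by linarith [hγ.2]) v
    (measurable_comp_const_sub
      (f := fun z => (if i = j then (1 : ℝ) else 0) - z i * z j / ‖z‖ ^ 2) ?_ v)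
    (fun w => abs_aker_entry_le (v - w) i j)
  fun_prop

lemma norm_rpow_eq_mul (γ : ℝ) {z : V3} (hz : z ≠ 0) : ‖z‖ ^ (γ + 1) = ‖z‖ ^ γ * ‖z‖ :=
  Real.rpow_add_one (norm_ne_zero_iff.2 hz) γ

lemma integrable_bker_mul {γ : ℝ} (hγ : γ ∈ Set.Ioo (-3 : ℝ) (-2)) (v : V3) (i : Fin 3) :
    Integrable fun w => bker γ (v - w) i * gaussM w := by
  have h := integrable_norm_rpow_mul (β := γ + 1) (by linarith [hγ.1]) (by linarith [hγ.2]) v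
    (measurable_comp_const_sub (f := fun z => z i / ‖z‖) (by fun_prop) v)
    (fun w => by
      rw [abs_div, abs_norm]
      exact div_le_one_of_le₀ (abs_apply_le_norm _ i) (norm_nonneg _))
  refine (h.const_mul (-2)).congr (Eventually.of_forall fun w => ?_)
  rcases eq_or_ne (v - w) 0 with hz | hz
  · simp [bker, hz]
  · have := norm_ne_zero_iff.2 hz
    simp only [bker, norm_rpow_eq_mul γ hz]
    field_simp

lemma tendsto_Jfun {β : ℝ} (hβ : -3 < β) (hβ0 : β ≤ 0) :
    Tendsto (fun v => jap v ^ (-β) * Jfun β v) normAtTop (nhds 1) := by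
  simpa [Jfun] using tendsto_jap_rpow_mul_integral hβ hβ0 (g := fun _ _ => 1)
    (fun _ => measurable_const) (by simp) (fun _ => tendsto_const_nhds)

lemma sum_abar_diag {γ : ℝ} (hγ : γ ∈ Set.Ioo (-3 : ℝ) (-2)) (v : V3) :
    ∑ i, abar γ v i i = 2 * Jfun (γ + 2) v := by
  simp only [abar, Jfun]
  rw [← integral_finsetSum _ fun i _ => integrable_aker_mul hγ v i i, ← integral_const_mul]
  congr 1 with w
  rw [← Finset.sum_mul, ← mul_assoc]
  congr 1
  rcases eq_or_ne (v - w) 0 with hz | hz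
  · have : γ + 2 ≠ 0 := by linarith [hγ.2]
    simp [aker, hz, Real.zero_rpow this]
  · have hn : ‖v - w‖ ^ 2 ≠ 0 := pow_ne_zero 2 (norm_ne_zero_iff.2 hz)
    have hs : ∑ i, (v - w) i * (v - w) i = ‖v - w‖ ^ 2 := by
      rw [← inner_eq_sum, real_inner_self_eq_norm_sq]
    simp only [aker, if_true, ← Finset.mul_sum, Finset.sum_sub_distrib, ← Finset.sum_div, hs,
      div_self hn]
    norm_num
    ring

lemma inner_sub_sq_div_le (v w : V3) (hz : v - w ≠ 0) :
    ‖v‖ ^ 2 - inner ℝ (v - w) v ^ 2 / ‖v - w‖ ^ 2 ≤ ‖w‖ ^ 2 := by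
  have hn : 0 < ‖v - w‖ ^ 2 := pow_pos (norm_pos_iff.2 hz) 2
  rw [sub_le_iff_le_add, ← sub_le_iff_le_add', le_div_iff₀ hn, @norm_sub_sq_real,
    inner_sub_left, real_inner_self_eq_norm_sq, real_inner_comm v w]
  nlinarith [sq_nonneg (‖w‖ ^ 2 - inner ℝ v w)]

lemma inner_sq_div_le (z v : V3) : inner ℝ z v ^ 2 / ‖z‖ ^ 2 ≤ ‖v‖ ^ 2 := by
  refine div_le_of_le_mul₀ (sq_nonneg _) (sq_nonneg _) ?_
  rw [← mul_pow, ← sq_abs, mul_comm]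
  exact pow_le_pow_left₀ (abs_nonneg _) (abs_real_inner_le_norm z v) 2

lemma sum_abar_mul_mul {γ : ℝ} (hγ : γ ∈ Set.Ioo (-3 : ℝ) (-2)) (v : V3) :
    ∑ i, ∑ j, abar γ v i j * (v i * v j) = jap v ^ 2 * ∫ w, ‖v - w‖ ^ (γ + 2) *
      ((‖v‖ ^ 2 - inner ℝ (v - w) v ^ 2 / ‖v - w‖ ^ 2) / jap v ^ 2) * gaussM w := by
  simp only [abar, ← integral_mul_const, ← integral_const_mul]
  have hi := fun i j => (integrable_aker_mul hγ v i j).mul_const (v i * v j)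
  simp_rw [← integral_finsetSum _ fun j _ => hi _ j]
  rw [← integral_finsetSum _ fun i _ => integrable_finsetSum _ fun j _ => hi i j]
  congr 1 with w
  have hj := (jap_pos v).ne'
  have hv : ‖v‖ ^ 2 = ∑ i, v i * v i := by rw [← inner_eq_sum, real_inner_self_eq_norm_sq]
  have key : ∑ i, ∑ j, aker γ (v - w) i j * (v i * v j) = ‖v - w‖ ^ (γ + 2) *
      (‖v‖ ^ 2 - inner ℝ (v - w) v ^ 2 / ‖v - w‖ ^ 2) := by
    rw [hv, inner_eq_sum]
    simp only [aker, Fin.sum_univ_three]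
    simp
    ring
  calc ∑ i, ∑ j, aker γ (v - w) i j * gaussM w * (v i * v j)
      = (∑ i, ∑ j, aker γ (v - w) i j * (v i * v j)) * gaussM w := by
        simp only [Finset.sum_mul, mul_right_comm]
    _ = _ := by rw [key]; field_simp

lemma tendsto_sum_abar_mul_mul {γ : ℝ} (hγ : γ ∈ Set.Ioo (-3 : ℝ) (-2)) :
    Tendsto (fun v => jap v ^ (-(γ + 4)) * ∑ i, ∑ j, abar γ v i j * (v i * v j))
      normAtTop (nhds 0) := by
  have h := tendsto_jap_rpow_mul_integral (β := γ + 2) (by linarith [hγ.1]) (by linarith [hγ.2])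
    (g := fun v w => (‖v‖ ^ 2 - inner ℝ (v - w) v ^ 2 / ‖v - w‖ ^ 2) / jap v ^ 2) (L := 0)
    (fun v => by fun_prop) (fun v w => ?_) (fun w => ?_)
  · refine h.congr fun v => ?_
    have hj := jap_pos v
    rw [sum_abar_mul_mul hγ, ← mul_assoc, ← Real.rpow_natCast (jap v) 2, ← Real.rpow_add hj]
    congr 2
    push_cast
    ring
  · have h1 := inner_sq_div_le (v - w) v
    have h2 : 0 ≤ inner ℝ (v - w) v ^ 2 / ‖v - w‖ ^ 2 := by positivity
    have h3 := jap_sq v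
    rw [abs_of_nonneg (div_nonneg (by linarith) (sq_nonneg _))]
    exact div_le_one_of_le₀ (by linarith) (sq_nonneg _)
  · have h0 : Tendsto (fun v => ‖w‖ ^ 2 / jap v ^ 2) normAtTop (nhds 0) :=
      tendsto_const_nhds.div_atTop ((tendsto_pow_atTop two_ne_zero).comp tendsto_jap)
    refine squeeze_zero' (Eventually.of_forall fun v => ?_) ?_ h0
    · exact div_nonneg (by linarith [inner_sq_div_le (v - w) v]) (sq_nonneg _)
    · filter_upwards [tendsto_norm_normAtTop.eventually_gt_atTop ‖w‖] with v hv
      refine div_le_div_of_nonneg_right (inner_sub_sq_div_le v w ?_) (sq_nonneg _)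
      rintro h
      rw [sub_eq_zero.1 h] at hv
      exact lt_irrefl _ hv

lemma sum_bbar_mul {γ : ℝ} (hγ : γ ∈ Set.Ioo (-3 : ℝ) (-2)) (v : V3) :
    ∑ i, bbar γ v i * v i = -2 * jap v * ∫ w, ‖v - w‖ ^ (γ + 1) *
      (inner ℝ (v - w) v / (‖v - w‖ * jap v)) * gaussM w := by
  simp only [bbar, ← integral_mul_const, ← integral_const_mul]
  rw [← integral_finsetSum _ fun i _ => (integrable_bker_mul hγ v i).mul_const (v i)]
  congr 1 with w
  have hj := (jap_pos v).ne'
  have key : ∑ i, bker γ (v - w) i * gaussM w * v i =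
      -2 * ‖v - w‖ ^ γ * inner ℝ (v - w) v * gaussM w := by
    rw [inner_eq_sum, Finset.mul_sum, Finset.sum_mul]
    exact Finset.sum_congr rfl fun i _ => by rw [bker]; ring
  rw [key]
  rcases eq_or_ne (v - w) 0 with hz | hz
  · simp [hz]
  · have := norm_ne_zero_iff.2 hz
    rw [norm_rpow_eq_mul γ hz]
    field_simp

lemma tendsto_sum_bbar_mul {γ : ℝ} (hγ : γ ∈ Set.Ioo (-3 : ℝ) (-2)) :
    Tendsto (fun v => jap v ^ (-(γ + 2)) * ∑ i, bbar γ v i * v i) normAtTop (nhds (-2)) := by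
  have hbound : ∀ z y : V3, |inner ℝ z y / ‖z‖| ≤ ‖y‖ := fun z y => by
    rw [abs_div, abs_norm]
    exact div_le_of_le_mul₀ (norm_nonneg _) (norm_nonneg _)
      ((abs_real_inner_le_norm z y).trans_eq (mul_comm _ _))
  have h := tendsto_jap_rpow_mul_integral (β := γ + 1) (by linarith [hγ.1]) (by linarith [hγ.2])
    (g := fun v w => inner ℝ (v - w) v / (‖v - w‖ * jap v)) (L := 1)
    (fun v => by fun_prop) (fun v w => ?_) (fun w => ?_)
  · have h2 := h.const_mul (-2)
    rw [mul_one] at h2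
    refine h2.congr fun v => ?_
    have hj := jap_pos v
    have he : jap v ^ (-(γ + 1)) = jap v ^ (-(γ + 2)) * jap v := by
      rw [← Real.rpow_add_one hj.ne']; ring_nf
    rw [sum_bbar_mul hγ, he]
    ring
  · rw [← div_div, abs_div, abs_of_pos (jap_pos v)]
    exact div_le_one_of_le₀ ((hbound _ _).trans (norm_le_jap v)) (jap_pos v).le
  · have h0 : Tendsto (fun v => ‖w‖ / jap v) normAtTop (nhds 0) :=
      tendsto_const_nhds.div_atTop tendsto_jap
    have h1 : Tendsto (fun v => inner ℝ (v - w) w / ‖v - w‖ / jap v) normAtTop (nhds 0) := by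
      refine squeeze_zero_norm (fun v => ?_) h0
      rw [norm_div, Real.norm_of_nonneg (jap_pos v).le]
      exact div_le_div_of_nonneg_right (hbound _ _) (jap_pos v).le
    have h2 := (tendsto_norm_sub_div_jap w).add h1
    rw [add_zero] at h2
    refine h2.congr fun v => ?_
    have hs : inner ℝ (v - w) v = ‖v - w‖ ^ 2 + inner ℝ (v - w) w := by
      rw [← real_inner_self_eq_norm_sq, ← inner_add_right, sub_add_cancel]
    rcases eq_or_ne (v - w) 0 with hz | hz
    · simp [hz]
    · have := norm_ne_zero_iff.2 hz
      have hj := (jap_pos v).ne'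
      rw [hs]
      field_simp

lemma hasFDerivAt_jap_rpow (k : ℝ) (v : V3) :
    HasFDerivAt (fun w => jap w ^ k) ((k * jap v ^ (k - 2)) • innerSL ℝ v) v := by
  have hp : ∀ (w : V3) (l : ℝ), jap w ^ l = (1 + ‖w‖ ^ 2) ^ (l / 2) := fun w l => by
    rw [jap, Real.sqrt_eq_rpow, ← Real.rpow_mul (by positivity)]; ring_nf
  have h := ((hasStrictFDerivAt_norm_sq v).hasFDerivAt.const_add 1).rpow_const (p := k / 2)
    (Or.inl (by positivity))
  simp_rw [hp]
  refine h.congr_fderiv ?_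
  rw [show (k - 2) / 2 = k / 2 - 1 by ring, ← Nat.cast_smul_eq_nsmul ℝ, smul_smul]
  congr 1
  push_cast
  ring

lemma pd_jap_rpow (k : ℝ) (i : Fin 3) :
    pd i (fun w => jap w ^ k) = fun v => k * jap v ^ (k - 2) * v i := by
  ext v
  simp [pd, (hasFDerivAt_jap_rpow k v).fderiv, EuclideanSpace.inner_single_right]

lemma pd_pd_jap_rpow (k : ℝ) (i j : Fin 3) (v : V3) :
    pd i (pd j fun w => jap w ^ k) v = k * jap v ^ (k - 2) * (if i = j then 1 else 0) +
      k * (k - 2) * jap v ^ (k - 4) * (v i * v j) := by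
  have h := ((hasFDerivAt_jap_rpow (k - 2) v).const_mul k).mul
    (EuclideanSpace.proj (𝕜 := ℝ) j : V3 →L[ℝ] ℝ).hasFDerivAt
  rw [pd_jap_rpow, pd]
  erw [h.fderiv]
  simp [EuclideanSpace.inner_single_right, eq_comm (a := i)]
  ring_nf

lemma pd_jap_rpow_div (k : ℝ) (i : Fin 3) (v : V3) :
    pd i (fun w => jap w ^ k) v / jap v ^ k = k / jap v ^ 2 * v i := by
  have hj := jap_pos v
  simp only [pd_jap_rpow]
  rw [Real.rpow_sub hj, Real.rpow_ofNat]
  field_simp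

lemma pd_pd_jap_rpow_div (k : ℝ) (i j : Fin 3) (v : V3) :
    pd i (pd j fun w => jap w ^ k) v / jap v ^ k = k / jap v ^ 2 * (if i = j then 1 else 0) +
      k * (k - 2) / jap v ^ 4 * (v i * v j) := by
  have hj := jap_pos v
  rw [pd_pd_jap_rpow, Real.rpow_sub hj, Real.rpow_sub hj, Real.rpow_ofNat, Real.rpow_ofNat]
  field_simp

lemma sum_abar_mul_pd_pd (γ k : ℝ) (v : V3) :
    ∑ i, ∑ j, abar γ v i j * pd i (pd j fun w => jap w ^ k) v / jap v ^ k =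
      k / jap v ^ 2 * ∑ i, abar γ v i i +
      k * (k - 2) / jap v ^ 4 * ∑ i, ∑ j, abar γ v i j * (v i * v j) := by
  simp only [mul_div_assoc, pd_pd_jap_rpow_div, Fin.sum_univ_three]
  simp
  ring

lemma sum_abar_mul_pd_mul_pd (γ k : ℝ) (v : V3) :
    ∑ i, ∑ j, abar γ v i j * (pd i (fun w => jap w ^ k) v / jap v ^ k) *
      (pd j (fun w => jap w ^ k) v / jap v ^ k) =
      k ^ 2 / jap v ^ 4 * ∑ i, ∑ j, abar γ v i j * (v i * v j) := by
  simp only [pd_jap_rpow_div, Finset.mul_sum]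
  refine Finset.sum_congr rfl fun i _ => Finset.sum_congr rfl fun j _ => ?_
  ring

lemma sum_bbar_mul_pd (γ k : ℝ) (v : V3) :
    ∑ i, bbar γ v i * pd i (fun w => jap w ^ k) v / jap v ^ k =
      k / jap v ^ 2 * ∑ i, bbar γ v i * v i := by
  simp only [mul_div_assoc, pd_jap_rpow_div, Finset.mul_sum]
  exact Finset.sum_congr rfl fun i _ => by ring

lemma jap_rpow_neg_add (γ : ℝ) (n : ℕ) (v : V3) :
    jap v ^ (-(γ + n)) = jap v ^ (-γ) / jap v ^ n := by
  rw [neg_add, ← sub_eq_add_neg, Real.rpow_sub (jap_pos v), Real.rpow_natCast]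

lemma jap_rpow_neg_add_two (γ : ℝ) (v : V3) :
    jap v ^ (-(γ + 2)) = jap v ^ (-γ) / jap v ^ 2 := by
  exact_mod_cast jap_rpow_neg_add γ 2 v

lemma jap_rpow_neg_add_four (γ : ℝ) (v : V3) :
    jap v ^ (-(γ + 4)) = jap v ^ (-γ) / jap v ^ 4 := by
  exact_mod_cast jap_rpow_neg_add γ 4 v

lemma tendsto_zeta_jap_rpow {γ : ℝ} (hγ : γ ∈ Set.Ioo (-3 : ℝ) (-2)) (k : ℝ) :
    Tendsto (fun v => zeta γ (fun w => jap w ^ k) v * jap v ^ (-γ)) normAtTop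
      (nhds (2 * ((γ + 3) / 2 - k))) := by
  have hJ := (tendsto_Jfun hγ.1 (by linarith [hγ.2])).const_mul (γ + 3)
  have hT := (tendsto_Jfun (β := γ + 2) (by linarith [hγ.1]) (by linarith [hγ.2])).const_mul
    (2 * k)
  have hA := (tendsto_sum_abar_mul_mul hγ).const_mul (k * (k - 2) + k ^ 2)
  have hB := (tendsto_sum_bbar_mul hγ).const_mul (2 * k)
  convert! ((hT.add hA).add hB).add hJ using 1
  · ext v
    rw [zeta, sum_abar_mul_pd_pd, sum_abar_mul_pd_mul_pd, sum_bbar_mul_pd, sum_abar_diag hγ, cbar,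
      jap_rpow_neg_add_two, jap_rpow_neg_add_four]
    ring
  · congr 1
    ring

lemma tendsto_zetaT_jap_rpow {γ : ℝ} (hγ : γ ∈ Set.Ioo (-3 : ℝ) (-2)) (k : ℝ) :
    Tendsto (fun v => zetaT γ (fun w => jap w ^ k) v * jap v ^ (-γ)) normAtTop
      (nhds (2 * ((γ + 3) / 2 - k))) := by
  have hJ := (tendsto_Jfun hγ.1 (by linarith [hγ.2])).const_mul (γ + 3)
  have hA := (tendsto_sum_abar_mul_mul hγ).const_mul (k ^ 2)
  have hB := (tendsto_sum_bbar_mul hγ).const_mul k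
  convert! (hA.add hB).add hJ using 1
  · ext v
    rw [zetaT, sum_abar_mul_pd_mul_pd, sum_bbar_mul_pd, cbar,
      jap_rpow_neg_add_two, jap_rpow_neg_add_four]
    ring
  · congr 1
    ring

/-- Lemma 2.2 (1), first part: for the polynomial weight m = ⟨v⟩^k with k > (γ+3)/2,
limsup_{|v|→∞} ζ_m(v)⟨v⟩^{−γ} ≤ 2((γ+3)/2 − k) and the same for ζ̃_m. -/
theorem stmt6 (γ k : ℝ) (hγ : γ ∈ Set.Ioo (-3 : ℝ) (-2)) (hk : (γ + 3) / 2 < k) :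
    Filter.limsup (fun v : V3 => zeta γ (fun w => jap w ^ k) v * jap v ^ (-γ)) normAtTop
      ≤ 2 * ((γ + 3) / 2 - k) ∧
    Filter.limsup (fun v : V3 => zetaT γ (fun w => jap w ^ k) v * jap v ^ (-γ)) normAtTop
      ≤ 2 * ((γ + 3) / 2 - k) := by
  exact ⟨(tendsto_zeta_jap_rpow hγ k).limsup_eq.le, (tendsto_zetaT_jap_rpow hγ k).limsup_eq.le⟩
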